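/- arXiv:2005.01248 — 4 statements merged into one kernel-verified Lean document; each statement's English description precedes it below -/
import Mathlib

section
/- Let n ≥ 1 and let t be a real number with 1 < t < 2. Then there exists a constant c > 0, depending only on t, such that for all ξ₁, ξ₂ ∈ ℝⁿ with (ξ₁, ξ₂) ≠ (0, 0), ⟨Φ_t(ξ₁) − Φ_t(ξ₂), ξ₁ − ξ₂⟩ ≥ c·(|ξ₁| + |ξ₂|)^{t−2}·|ξ₁ − ξ₂|². -/
open RealInnerProductSpace

/-- The tangent line bound for the concave power `r ↦ r ^ (t - 1)`. -/
lemma rpow_sub_two_mul_le_of_pos {t a b : ℝ} (ht1 : 1 < t) (ht2 : t < 2) (ha : 0 < a)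
    (hb : 0 < b) :
    b ^ (t - 2) * b ≤ a ^ (t - 2) * a - (t - 1) * a ^ (t - 2) * (a - b) := by
  have hpow : ∀ r : ℝ, 0 < r → r ^ (t - 2) * r = r ^ (t - 1) := fun r hr => by
    rw [← Real.rpow_add_one hr.ne']
    ring_nf
  have hbern := rpow_one_add_le_one_add_mul_self (s := b / a - 1)
    (by linarith [div_pos hb ha]) (by linarith : 0 ≤ t - 1) (by linarith)
  rw [add_sub_cancel, Real.div_rpow hb.le ha.le, div_le_iff₀ (by positivity)] at hbern
  rw [hpow b hb]
  refine hbern.trans_eq ?_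
  rw [← hpow a ha]
  field_simp
  ring

/-- Coercivity of `ξ ↦ ‖ξ‖ ^ (t - 2) • ξ` for `1 < t < 2`, for an ordered pair of norms. -/
lemma coercivity_of_norm_le {E : Type*} [NormedAddCommGroup E] [InnerProductSpace ℝ E]
    {t : ℝ} (ht1 : 1 < t) (ht2 : t < 2) {x y : E} (hx : x ≠ 0) (hyx : ‖y‖ ≤ ‖x‖) :
    (t - 1) * (‖x‖ + ‖y‖) ^ (t - 2) * ‖x - y‖ ^ 2 ≤
      ⟪(‖x‖ ^ (t - 2) • x) - (‖y‖ ^ (t - 2) • y), x - y⟫ := by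
  have ha : 0 < ‖x‖ := norm_pos_iff.2 hx
  have hS : (‖x‖ + ‖y‖) ^ (t - 2) ≤ ‖x‖ ^ (t - 2) :=
    Real.rpow_le_rpow_of_nonpos ha (by linarith [norm_nonneg y]) (by linarith)
  have hA : 0 < ‖x‖ ^ (t - 2) := by positivity
  have hle : (t - 1) * (‖x‖ + ‖y‖) ^ (t - 2) * ‖x - y‖ ^ 2 ≤
      (t - 1) * ‖x‖ ^ (t - 2) * ‖x - y‖ ^ 2 := by
    have : 0 ≤ t - 1 := by linarith
    gcongr
  refine hle.trans ?_
  rcases eq_or_ne y 0 with rfl | hy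
  · simp only [smul_zero, sub_zero, real_inner_smul_left, real_inner_self_eq_norm_sq]
    have : 0 ≤ ‖x‖ ^ (t - 2) * ‖x‖ ^ 2 := by positivity
    nlinarith
  have hb : 0 < ‖y‖ := norm_pos_iff.2 hy
  have hAB : ‖x‖ ^ (t - 2) ≤ ‖y‖ ^ (t - 2) :=
    Real.rpow_le_rpow_of_nonpos hb hyx (by linarith)
  have htan := rpow_sub_two_mul_le_of_pos ht1 ht2 ha hb
  have hp := real_inner_le_norm x y
  rw [norm_sub_sq_real]
  simp only [inner_sub_left, inner_sub_right, real_inner_smul_left, real_inner_self_eq_norm_sq,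
    real_inner_comm x y]
  generalize ‖x‖ ^ (t - 2) = A at *
  generalize ‖y‖ ^ (t - 2) = B at *
  generalize ⟪x, y⟫ = p at *
  have hcoef : 0 ≤ A + B - 2 * (t - 1) * A := by nlinarith
  nlinarith [mul_nonneg hcoef (sub_nonneg.2 hp),
    mul_nonneg (sub_nonneg.2 htan) (sub_nonneg.2 hyx)]

/-- Coercivity inequality, singular case `1 < t < 2`:
there is `c = c(t) > 0` with
`⟨Φ_t(ξ₁) − Φ_t(ξ₂), ξ₁ − ξ₂⟩ ≥ c (|ξ₁| + |ξ₂|)^{t−2} |ξ₁ − ξ₂|²`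
for `(ξ₁, ξ₂) ≠ (0, 0)`, where `Φ_t(ξ) = |ξ|^{t-2} ξ` (with `Φ_t(0) = 0`). -/
theorem stmt_4 (n : ℕ) (hn : 1 ≤ n) (t : ℝ) (ht1 : 1 < t) (ht2 : t < 2) :
    ∃ c : ℝ, 0 < c ∧ ∀ ξ₁ ξ₂ : EuclideanSpace ℝ (Fin n), (ξ₁, ξ₂) ≠ (0, 0) →
      c * (‖ξ₁‖ + ‖ξ₂‖) ^ (t - 2) * ‖ξ₁ - ξ₂‖ ^ 2 ≤
        ⟪(‖ξ₁‖ ^ (t - 2) • ξ₁) - (‖ξ₂‖ ^ (t - 2) • ξ₂), ξ₁ - ξ₂⟫ := by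
  refine ⟨t - 1, by linarith, fun x y hxy => ?_⟩
  rcases le_total ‖y‖ ‖x‖ with h | h
  · refine coercivity_of_norm_le ht1 ht2 ?_ h
    rintro rfl
    exact hxy (by simpa using h)
  · have hy : y ≠ 0 := by
      rintro rfl
      exact hxy (by simpa using h)
    have key := coercivity_of_norm_le ht1 ht2 hy h
    rwa [add_comm, norm_sub_rev, ← inner_neg_neg, neg_sub, neg_sub] at key
end

section
/- Let n ≥ 1 and let t be a real number with 1 < t < 2. Then there exists a constant C > 0, depending only on t, such that for every ε ∈ (0, 1] and all ξ₁, ξ₂ ∈ ℝⁿ, |ξ₁ − ξ₂|^{t} ≤ C·ε^{(t−2)/t}·⟨Φ_t(ξ₁) − Φ_t(ξ₂), ξ₁ − ξ₂⟩ + ε·|ξ₁|^{t}. -/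
open RealInnerProductSpace

theorem Real.mul_rpow_sub_two_mul_sub_le {t a b : ℝ} (ht1 : 1 ≤ t) (ht2 : t ≤ 2) (ha : 0 < a)
    (hb : 0 ≤ b) : (t - 1) * a ^ (t - 2) * (a - b) ≤ a ^ (t - 1) - b ^ (t - 1) := by
  have hpow : a ^ (t - 1) = a ^ (t - 2) * a := by
    rw [← Real.rpow_add_one ha.ne']; ring_nf
  have hs : -1 ≤ b / a - 1 := by linarith [div_nonneg hb ha.le]
  have bernoulli := rpow_one_add_le_one_add_mul_self hs (p := t - 1) (by linarith) (by linarith)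
  rw [add_sub_cancel, Real.div_rpow hb ha.le, div_le_iff₀ (Real.rpow_pos_of_pos ha _)] at bernoulli
  have : (1 + (t - 1) * (b / a - 1)) * a ^ (t - 1)
      = a ^ (t - 1) - (t - 1) * a ^ (t - 2) * (a - b) := by
    rw [hpow]; field_simp; ring
  linarith

theorem Real.mul_add_rpow_sub_two_mul_sq_sub_le {t a b : ℝ} (ht1 : 1 ≤ t) (ht2 : t < 2)
    (ha : 0 ≤ a) (hb : 0 ≤ b) :
    (t - 1) * (a + b) ^ (t - 2) * (a - b) ^ 2 ≤ (a ^ (t - 1) - b ^ (t - 1)) * (a - b) := by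
  wlog hab : b ≤ a generalizing a b
  · have := this hb ha (not_le.mp hab).le
    rw [add_comm b a] at this
    linarith
  rcases ha.eq_or_lt with rfl | ha
  · obtain rfl : b = 0 := le_antisymm hab hb
    simp
  have hanti : (a + b) ^ (t - 2) ≤ a ^ (t - 2) :=
    Real.rpow_le_rpow_of_nonpos ha (by linarith) (by linarith)
  have htangent := Real.mul_rpow_sub_two_mul_sub_le ht1 ht2.le ha hb
  calc (t - 1) * (a + b) ^ (t - 2) * (a - b) ^ 2
      ≤ (t - 1) * a ^ (t - 2) * (a - b) ^ 2 := by
        have : 0 ≤ t - 1 := by linarith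
        gcongr
    _ = (t - 1) * a ^ (t - 2) * (a - b) * (a - b) := by ring
    _ ≤ _ := mul_le_mul_of_nonneg_right htangent (by linarith)

/-- Strong monotonicity of `x ↦ ‖x‖ ^ (t - 2) • x` in the singular range `1 ≤ t < 2`. -/
theorem mul_add_norm_rpow_mul_sq_norm_sub_le_inner {E : Type*} [NormedAddCommGroup E]
    [InnerProductSpace ℝ E] {t : ℝ} (ht1 : 1 < t) (ht2 : t < 2) (x y : E) :
    (t - 1) * (‖x‖ + ‖y‖) ^ (t - 2) * ‖x - y‖ ^ 2 ≤
      ⟪(‖x‖ ^ (t - 2) • x) - (‖y‖ ^ (t - 2) • y), x - y⟫ := by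
  have hpow (z : E) : ‖z‖ ^ (t - 1) = ‖z‖ ^ (t - 2) * ‖z‖ := by
    rw [← Real.rpow_add_one' (norm_nonneg z) (by linarith)]; ring_nf
  have hradial := Real.mul_add_rpow_sub_two_mul_sq_sub_le ht1.le ht2 (norm_nonneg x)
    (norm_nonneg y)
  rw [hpow, hpow] at hradial
  have hcross : 0 ≤ (‖x‖ ^ (t - 2) + ‖y‖ ^ (t - 2) - 2 * ((t - 1) * (‖x‖ + ‖y‖) ^ (t - 2))) *
      (‖x‖ * ‖y‖ - ⟪x, y⟫) := by
    rcases eq_or_ne x 0 with rfl | hx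
    · simp
    rcases eq_or_ne y 0 with rfl | hy
    · simp
    have hx := norm_pos_iff.mpr hx
    have hy := norm_pos_iff.mpr hy
    have hleft : (‖x‖ + ‖y‖) ^ (t - 2) ≤ ‖x‖ ^ (t - 2) :=
      Real.rpow_le_rpow_of_nonpos hx (by linarith) (by linarith)
    have hright : (‖x‖ + ‖y‖) ^ (t - 2) ≤ ‖y‖ ^ (t - 2) :=
      Real.rpow_le_rpow_of_nonpos hy (by linarith) (by linarith)
    have hcoef : (t - 1) * (‖x‖ + ‖y‖) ^ (t - 2) ≤ (‖x‖ + ‖y‖) ^ (t - 2) :=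
      mul_le_of_le_one_left (by positivity) (by linarith)
    exact mul_nonneg (by linarith) (sub_nonneg.mpr (real_inner_le_norm x y))
  rw [norm_sub_sq_real]
  simp only [inner_sub_left, inner_sub_right, real_inner_smul_left, real_inner_self_eq_norm_sq,
    real_inner_comm x y]
  linarith

/-- Key small-parameter estimate, singular case `1 < t < 2`:
there is `C = C(t) > 0` such that for all `ε ∈ (0,1]` and all `ξ₁, ξ₂`,
`|ξ₁ − ξ₂|^t ≤ C ε^{(t−2)/t} ⟨Φ_t(ξ₁) − Φ_t(ξ₂), ξ₁ − ξ₂⟩ + ε |ξ₁|^t`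
where `Φ_t(ξ) = |ξ|^{t-2} ξ` (with `Φ_t(0) = 0`). -/
theorem stmt_5 (n : ℕ) (hn : 1 ≤ n) (t : ℝ) (ht1 : 1 < t) (ht2 : t < 2) :
    ∃ C : ℝ, 0 < C ∧ ∀ ε : ℝ, 0 < ε → ε ≤ 1 → ∀ ξ₁ ξ₂ : EuclideanSpace ℝ (Fin n),
      ‖ξ₁ - ξ₂‖ ^ t ≤
        C * ε ^ ((t - 2) / t) *
            ⟪(‖ξ₁‖ ^ (t - 2) • ξ₁) - (‖ξ₂‖ ^ (t - 2) • ξ₂), ξ₁ - ξ₂⟫ +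
          ε * ‖ξ₁‖ ^ t := by
  have ht : 0 < t := by linarith
  have hc : 0 < t - 1 := by linarith
  refine ⟨((t - 1) * 3 ^ (t - 2))⁻¹, by positivity, fun ε hε hε1 x y => ?_⟩
  have hmono := mul_add_norm_rpow_mul_sq_norm_sub_le_inner ht1 ht2 x y
  set I := ⟪(‖x‖ ^ (t - 2) • x) - (‖y‖ ^ (t - 2) • y), x - y⟫
  have hI : 0 ≤ I := le_trans (by positivity) hmono
  by_cases hsmall : ‖x - y‖ ^ t ≤ ε * ‖x‖ ^ t
  · exact hsmall.trans (le_add_of_nonneg_left (by positivity))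
  have hlarge := not_le.mp hsmall
  have hd : 0 < ‖x - y‖ := by
    refine (norm_nonneg _).lt_of_ne fun h => ?_
    rw [← h, Real.zero_rpow ht.ne'] at hlarge
    exact absurd hlarge (not_lt.mpr (by positivity))
  set δ := ε ^ (-t⁻¹)
  have hδ : 1 ≤ δ := Real.one_le_rpow_of_pos_of_le_one_of_nonpos hε hε1 (by simpa using ht.le)
  have hδε : δ ^ t * ε = 1 := by
    rw [← Real.rpow_mul hε.le, neg_mul, inv_mul_cancel₀ ht.ne', Real.rpow_neg_one,
      inv_mul_cancel₀ hε.ne']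
  have hx : ‖x‖ ≤ δ * ‖x - y‖ := by
    rw [← Real.rpow_le_rpow_iff (norm_nonneg x) (by positivity) ht,
      Real.mul_rpow (by positivity) hd.le]
    calc ‖x‖ ^ t = δ ^ t * (ε * ‖x‖ ^ t) := by rw [← mul_assoc, hδε, one_mul]
      _ ≤ δ ^ t * ‖x - y‖ ^ t := by gcongr
  have hsum : ‖x‖ + ‖y‖ ≤ 3 * δ * ‖x - y‖ := by
    have := norm_le_norm_add_norm_sub x y
    have := le_mul_of_one_le_left hd.le hδ
    linarith
  have hpos : 0 < ‖x‖ + ‖y‖ := hd.trans_le (norm_sub_le x y)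
  have hlower : (3 * δ * ‖x - y‖) ^ (t - 2) ≤ (‖x‖ + ‖y‖) ^ (t - 2) :=
    Real.rpow_le_rpow_of_nonpos hpos hsum (by linarith)
  have hexp : ε ^ ((t - 2) / t) * δ ^ (t - 2) = 1 := by
    rw [← Real.rpow_mul hε.le, ← Real.rpow_add hε, ← Real.rpow_zero ε]
    congr 1
    field_simp
    ring
  have hpow : ‖x - y‖ ^ (t - 2) * ‖x - y‖ ^ 2 = ‖x - y‖ ^ t := by
    rw [← Real.rpow_natCast, ← Real.rpow_add hd]
    norm_num
  have hδ0 : 0 ≤ δ := by positivity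
  refine le_trans ?_ (le_add_of_nonneg_right (by positivity))
  calc ‖x - y‖ ^ t
      = ((t - 1) * 3 ^ (t - 2))⁻¹ * ε ^ ((t - 2) / t) *
          ((t - 1) * (3 * δ * ‖x - y‖) ^ (t - 2) * ‖x - y‖ ^ 2) := by
        rw [Real.mul_rpow (by positivity) hd.le, Real.mul_rpow (by norm_num) hδ0]
        have h3 : (3 : ℝ) ^ (t - 2) ≠ 0 := by positivity
        calc ‖x - y‖ ^ t = (((t - 1) * 3 ^ (t - 2))⁻¹ * ((t - 1) * 3 ^ (t - 2))) *
              (ε ^ ((t - 2) / t) * δ ^ (t - 2)) * (‖x - y‖ ^ (t - 2) * ‖x - y‖ ^ 2) := by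
              rw [inv_mul_cancel₀ (mul_ne_zero hc.ne' h3), hexp, hpow, one_mul, one_mul]
          _ = _ := by ring
    _ ≤ ((t - 1) * 3 ^ (t - 2))⁻¹ * ε ^ ((t - 2) / t) *
          ((t - 1) * (‖x‖ + ‖y‖) ^ (t - 2) * ‖x - y‖ ^ 2) := by gcongr
    _ ≤ _ := by gcongr
end

section
/- (Caccioppoli-type inequality) Let Ω ⊆ ℝⁿ be a bounded open set, let 1 < p ≤ q < ∞ be real numbers, and let a : Ω → ℝ be continuous with a ≥ 0. Let u : Ω → ℝ be continuously differentiable, and suppose that ∫_Ω ⟨A(x, ∇u(x)), ∇η(x)⟩ dx = 0 for every continuously differentiable η : Ω → ℝ with compact support in Ω. Then there exists a constant C > 0, depending only on p and q, such that for every smooth ζ : Ω → ℝ with compact support in Ω and 0 ≤ ζ ≤ 1, ∫_Ω ζ(x)^q · (|∇u(x)|^p + a(x)|∇u(x)|^q) dx ≤ C · ∫_Ω (|u(x)∇ζ(x)|^p + a(x)|u(x)∇ζ(x)|^q) dx. -/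
open RealInnerProductSpace MeasureTheory

/-- The weighted Young inequality used to absorb the gradient term. -/
lemma rpow_sub_one_mul_le_half_add {r q s t : ℝ} (hr : 1 < r) (hrq : r ≤ q) (hs : 0 ≤ s)
    (ht : 0 ≤ t) : q * (s ^ (r - 1) * t) ≤ 1 / 2 * s ^ r + 1 / 2 * (2 * q) ^ q * t ^ r := by
  have hsr : s ^ r = s ^ (r - 1) * s := by
    rw [← Real.rpow_add_one' hs (by linarith)]
    simp
  have htr : t ^ r = t ^ (r - 1) * t := by
    rw [← Real.rpow_add_one' ht (by linarith)]
    simp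
  have hs' : 0 ≤ s ^ (r - 1) := by positivity
  rcases le_total (2 * q * t) s with h | h
  · have h₁ := mul_le_mul_of_nonneg_left h hs'
    have h₂ : 0 ≤ 1 / 2 * (2 * q) ^ q * t ^ r := by
      have : 0 ≤ 2 * q := by linarith
      positivity
    rw [hsr]
    linarith
  · have hq : 1 ≤ 2 * q := by linarith
    have h₁ : s ^ (r - 1) ≤ (2 * q) ^ (r - 1) * t ^ (r - 1) := by
      rw [← Real.mul_rpow (by linarith) ht]
      exact Real.rpow_le_rpow hs h (by linarith)
    have h₂ : (2 * q) ^ (r - 1) ≤ (2 * q) ^ (q - 1) :=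
      Real.rpow_le_rpow_of_exponent_le hq (by linarith)
    have h₃ : (2 * q) ^ q = (2 * q) ^ (q - 1) * (2 * q) := by
      rw [← Real.rpow_add_one (by linarith)]
      simp
    have h₄ : s ^ (r - 1) ≤ (2 * q) ^ (q - 1) * t ^ (r - 1) :=
      h₁.trans (mul_le_mul_of_nonneg_right h₂ (by positivity))
    have h₅ : q * (s ^ (r - 1) * t) ≤ q * ((2 * q) ^ (q - 1) * t ^ (r - 1) * t) := by
      have : 0 ≤ q := by linarith
      gcongr
    have h₆ : 0 ≤ s ^ r := by positivity
    rw [h₃, htr]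
    linarith

lemma cutoff_rpow_mul_le {r q z g t : ℝ} (hr : 1 < r) (hrq : r ≤ q) (hz : 0 ≤ z) (hz' : z ≤ 1)
    (hg : 0 ≤ g) (ht : 0 ≤ t) :
    q * z ^ (q - 1) * (g ^ (r - 1) * t) ≤
      1 / 2 * (z ^ q * g ^ r) + 1 / 2 * (2 * q) ^ q * t ^ r := by
  have hr0 : r ≠ 0 := by linarith
  have key := rpow_sub_one_mul_le_half_add hr hrq (s := z ^ (q / r) * g) (by positivity) ht
  rw [Real.mul_rpow (by positivity) hg, Real.mul_rpow (by positivity) hg, ← Real.rpow_mul hz,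
    ← Real.rpow_mul hz, div_mul_cancel₀ _ hr0] at key
  have hle : z ^ (q - 1) ≤ z ^ (q / r * (r - 1)) := by
    apply Real.rpow_le_rpow_of_exponent_ge' hz hz'
    · have : 0 ≤ q / r := div_nonneg (by linarith) (by linarith)
      exact mul_nonneg this (by linarith)
    · have h₁ : 1 ≤ q / r := by rwa [one_le_div (by linarith)]
      have h₂ : q / r * (r - 1) = q - q / r := by field_simp
      linarith
  refine le_trans ?_ key
  have hq : 0 ≤ q := by linarith
  calc q * z ^ (q - 1) * (g ^ (r - 1) * t) = q * (z ^ (q - 1) * g ^ (r - 1) * t) := by ring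
    _ ≤ _ := by gcongr

section InnerProductSpace

variable {E : Type*} [NormedAddCommGroup E] [InnerProductSpace ℝ E]

lemma continuous_norm_rpow_sub_two_smul {r : ℝ} (hr : 1 < r) :
    Continuous fun v : E ↦ ‖v‖ ^ (r - 2) • v := by
  rw [continuous_iff_continuousAt]
  intro v
  by_cases hv : v = 0
  · subst hv
    have hnorm : ∀ w : E, ‖‖w‖ ^ (r - 2) • w‖ = ‖w‖ ^ (r - 1) := fun w ↦ by
      rw [norm_smul, Real.norm_of_nonneg (by positivity),
        ← Real.rpow_add_one' (norm_nonneg w) (by linarith)]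
      ring_nf
    rw [ContinuousAt, smul_zero, tendsto_zero_iff_norm_tendsto_zero]
    simp only [hnorm]
    have : Continuous fun w : E ↦ ‖w‖ ^ (r - 1) :=
      continuous_norm.rpow_const fun _ ↦ Or.inr (by linarith)
    simpa [Real.zero_rpow (by linarith : r - 1 ≠ 0)] using this.tendsto 0
  · exact (continuousAt_id.norm.rpow_const (Or.inl (norm_ne_zero_iff.2 hv))).smul continuousAt_id

lemma norm_rpow_sub_two_mul_inner_self {r : ℝ} (hr : 1 < r) (v : E) :
    ‖v‖ ^ (r - 2) * ⟪v, v⟫ = ‖v‖ ^ r := by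
  rw [real_inner_self_eq_norm_sq, ← Real.rpow_natCast,
    ← Real.rpow_add' (norm_nonneg v) (by push_cast; linarith)]
  push_cast
  ring_nf

lemma abs_norm_rpow_sub_two_mul_inner_le {r : ℝ} (hr : 1 < r) (v w : E) :
    |‖v‖ ^ (r - 2) * ⟪v, w⟫| ≤ ‖v‖ ^ (r - 1) * ‖w‖ := by
  rw [abs_mul, abs_of_nonneg (by positivity)]
  calc ‖v‖ ^ (r - 2) * |⟪v, w⟫| ≤ ‖v‖ ^ (r - 2) * (‖v‖ * ‖w‖) := by
        gcongr
        exact abs_real_inner_le_norm v w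
    _ = ‖v‖ ^ (r - 1) * ‖w‖ := by
        rw [← mul_assoc, ← Real.rpow_add_one' (norm_nonneg v) (by linarith)]
        ring_nf

/-- The contribution of a single power `r` to the pointwise absorption estimate. -/
lemma cutoff_power_energy_le {r q z b : ℝ} (hr : 1 < r) (hrq : r ≤ q) (hz : 0 ≤ z) (hz' : z ≤ 1)
    (v w : E) :
    z ^ q * ‖v‖ ^ r ≤
      2 * ⟪‖v‖ ^ (r - 2) • v, z ^ q • v + (b * (q * z ^ (q - 1))) • w⟫ +
        (2 * q) ^ q * ‖b • w‖ ^ r := by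
  have h₁ := cutoff_rpow_mul_le hr hrq hz hz' (norm_nonneg v) (norm_nonneg (b • w))
  have h₂ := (abs_le.1 (abs_norm_rpow_sub_two_mul_inner_le hr v (b • w))).1
  have h₃ := norm_rpow_sub_two_mul_inner_self hr v
  have hc : 0 ≤ q * z ^ (q - 1) := mul_nonneg (by linarith) (by positivity)
  have h₄ := mul_le_mul_of_nonneg_left h₂ hc
  have h₅ : ⟪‖v‖ ^ (r - 2) • v, z ^ q • v + (b * (q * z ^ (q - 1))) • w⟫ =
      z ^ q * ‖v‖ ^ r + q * z ^ (q - 1) * (‖v‖ ^ (r - 2) * ⟪v, b • w⟫) := by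
    rw [← h₃]
    simp only [inner_add_right, real_inner_smul_left, real_inner_smul_right]
    ring
  rw [h₅]
  linarith

/-- The pointwise absorption estimate for the double-phase operator. -/
lemma cutoff_double_phase_energy_le {p q z b α : ℝ} (hp : 1 < p) (hpq : p ≤ q) (hz : 0 ≤ z)
    (hz' : z ≤ 1) (hα : 0 ≤ α) (v w : E) :
    z ^ q * (‖v‖ ^ p + α * ‖v‖ ^ q) ≤
      2 * ⟪‖v‖ ^ (p - 2) • v + α • ‖v‖ ^ (q - 2) • v, z ^ q • v + (b * (q * z ^ (q - 1))) • w⟫ +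
        (2 * q) ^ q * (‖b • w‖ ^ p + α * ‖b • w‖ ^ q) := by
  have h₁ := cutoff_power_energy_le (b := b) hp hpq hz hz' v w
  have h₂ := mul_le_mul_of_nonneg_left
    (cutoff_power_energy_le (b := b) (hp.trans_le hpq) le_rfl hz hz' v w) hα
  rw [inner_add_left, real_inner_smul_left _ _ α]
  linarith

lemma contDiff_mul_of_tsupport_subset {f g : E → ℝ} {s : Set E} (hs : IsOpen s)
    (hf : ContDiff ℝ 1 f) (hg : ContDiffOn ℝ 1 g s) (hfs : tsupport f ⊆ s) :
    ContDiff ℝ 1 fun x ↦ f x * g x := by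
  refine contDiff_iff_contDiffAt.2 fun x ↦ ?_
  by_cases hx : x ∈ tsupport f
  · exact hf.contDiffAt.mul (hg.contDiffAt (hs.mem_nhds (hfs hx)))
  · refine (contDiffAt_const (c := (0 : ℝ))).congr_of_eventuallyEq ?_
    filter_upwards [notMem_tsupport_iff_eventuallyEq.1 hx] with y hy
    simp [hy]

variable [CompleteSpace E]

lemma gradient_rpow_mul {ζ u : E → ℝ} {q : ℝ} {x : E} (hq : 1 ≤ q) (hζ : DifferentiableAt ℝ ζ x)
    (hu : DifferentiableAt ℝ u x) :
    gradient (fun y ↦ ζ y ^ q * u y) x =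
      ζ x ^ q • gradient u x + (u x * (q * ζ x ^ (q - 1))) • gradient ζ x := by
  have h : HasFDerivAt (fun y ↦ ζ y ^ q * u y) _ x :=
    (hζ.hasFDerivAt.rpow_const (p := q) (Or.inr hq)).mul hu.hasFDerivAt
  simp only [gradient]
  rw [h.fderiv]
  simp [smul_smul]

lemma gradient_eq_zero_of_notMem_tsupport {f : E → ℝ} {x : E} (hx : x ∉ tsupport f) :
    gradient f x = 0 := by
  rw [gradient, fderiv_of_notMem_tsupport ℝ hx, map_zero]

lemma ContDiffOn.continuousOn_gradient {f : E → ℝ} {s : Set E} (hf : ContDiffOn ℝ 1 f s)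
    (hs : IsOpen s) : ContinuousOn (gradient f) s :=
  (InnerProductSpace.toDual ℝ E).symm.continuous.comp_continuousOn
    (hf.continuousOn_fderiv_of_isOpen hs le_rfl)

end InnerProductSpace

lemma integrableOn_of_continuousOn_of_eq_zero {X : Type*} [TopologicalSpace X] [T2Space X]
    [MeasurableSpace X] [OpensMeasurableSpace X] {μ : Measure X} [IsFiniteMeasureOnCompacts μ]
    {f : X → ℝ} {s K : Set X} (hs : MeasurableSet s) (hK : IsCompact K) (hKs : K ⊆ s)
    (hf : ContinuousOn f s) (hf0 : ∀ x, x ∉ K → f x = 0) : IntegrableOn f s μ :=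
  ((hf.mono hKs).integrableOn_compact' hK hK.measurableSet).of_forall_sdiff_eq_zero hs
    fun x hx ↦ hf0 x hx.2

/-- Caccioppoli-type inequality for (classical-gradient) distributional solutions of the
double-phase equation `−div(|Du|^{p−2}Du + a(x)|Du|^{q−2}Du) = 0`:
there is `C = C(p,q) > 0` such that for any smooth cutoff `0 ≤ ζ ≤ 1` compactly
supported in `Ω`,
`∫_Ω ζ^q H(x, Du) ≤ C ∫_Ω H(x, u Dζ)` where `H(x,ξ) = |ξ|^p + a(x)|ξ|^q`. -/
theorem stmt_6 (n : ℕ) (hn : 1 ≤ n) (p q : ℝ) (hp : 1 < p) (hpq : p ≤ q) :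
    ∃ C : ℝ, 0 < C ∧
      ∀ (Ω : Set (EuclideanSpace ℝ (Fin n))), IsOpen Ω → Bornology.IsBounded Ω →
      ∀ a : EuclideanSpace ℝ (Fin n) → ℝ, ContinuousOn a Ω → (∀ x ∈ Ω, 0 ≤ a x) →
      ∀ u : EuclideanSpace ℝ (Fin n) → ℝ, ContDiffOn ℝ 1 u Ω →
      (∀ η : EuclideanSpace ℝ (Fin n) → ℝ, ContDiff ℝ 1 η → HasCompactSupport η →
        tsupport η ⊆ Ω →
        ∫ x in Ω, ⟪‖gradient u x‖ ^ (p - 2) • gradient u x +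
            a x • ‖gradient u x‖ ^ (q - 2) • gradient u x, gradient η x⟫ = 0) →
      ∀ ζ : EuclideanSpace ℝ (Fin n) → ℝ, ContDiff ℝ (⊤ : ℕ∞) ζ → HasCompactSupport ζ →
        tsupport ζ ⊆ Ω → (∀ x, 0 ≤ ζ x) → (∀ x, ζ x ≤ 1) →
        ∫ x in Ω, ζ x ^ q * (‖gradient u x‖ ^ p + a x * ‖gradient u x‖ ^ q) ≤
          C * ∫ x in Ω, (‖u x • gradient ζ x‖ ^ p + a x * ‖u x • gradient ζ x‖ ^ q) := by
  have hq : 1 < q := hp.trans_le hpq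
  have hp0 : p ≠ 0 := by linarith
  have hq0 : q ≠ 0 := by linarith
  refine ⟨(2 * q) ^ q, Real.rpow_pos_of_pos (by linarith) q, ?_⟩
  intro Ω hΩ _ a ha ha0 u hu hweak ζ hζ hζc hζΩ hζ0 hζ1
  have hζ' : ContDiff ℝ 1 ζ := hζ.of_le (by exact_mod_cast le_top)
  have hsupp : tsupport (fun x ↦ ζ x ^ q) ⊆ tsupport ζ := by
    refine closure_mono fun x hx ↦ ?_
    contrapose! hx
    simp [Function.notMem_support.1 hx, Real.zero_rpow hq0]
  have hζq : ContDiff ℝ 1 fun x ↦ ζ x ^ q :=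
    hζ'.rpow_const_of_le (m := 1) (by exact_mod_cast hq.le)
  have hη : ContDiff ℝ 1 fun x ↦ ζ x ^ q * u x :=
    contDiff_mul_of_tsupport_subset hΩ hζq hu (hsupp.trans hζΩ)
  have hηsupp : tsupport (fun x ↦ ζ x ^ q * u x) ⊆ tsupport ζ :=
    (tsupport_mul_subset_left (f := fun x ↦ ζ x ^ q) (g := u)).trans hsupp
  have hηc : HasCompactSupport fun x ↦ ζ x ^ q * u x :=
    hζc.of_isClosed_subset (isClosed_tsupport _) hηsupp
  have hweakη := hweak _ hη hηc (hηsupp.trans hζΩ)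
  have hDu : ContinuousOn (gradient u) Ω := hu.continuousOn_gradient hΩ
  have hDζ : ContinuousOn (gradient ζ) Ω := hζ'.contDiffOn.continuousOn_gradient hΩ
  have hDη : ContinuousOn (gradient fun x ↦ ζ x ^ q * u x) Ω :=
    hη.contDiffOn.continuousOn_gradient hΩ
  have hnorm : ∀ {v : EuclideanSpace ℝ (Fin n) → EuclideanSpace ℝ (Fin n)} {r : ℝ}, 1 < r →
      ContinuousOn v Ω → ContinuousOn (fun x ↦ ‖v x‖ ^ r) Ω := fun hr hv ↦
    hv.norm.rpow_const fun _ _ ↦ Or.inr (by linarith)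
  have hflux : ContinuousOn (fun x ↦ ‖gradient u x‖ ^ (p - 2) • gradient u x +
      a x • ‖gradient u x‖ ^ (q - 2) • gradient u x) Ω :=
    ((continuous_norm_rpow_sub_two_smul hp).comp_continuousOn hDu).add
      (ha.smul ((continuous_norm_rpow_sub_two_smul hq).comp_continuousOn hDu))
  have huDζ : ContinuousOn (fun x ↦ u x • gradient ζ x) Ω := hu.continuousOn.smul hDζ
  have hleft : IntegrableOn
      (fun x ↦ ζ x ^ q * (‖gradient u x‖ ^ p + a x * ‖gradient u x‖ ^ q)) Ω := by
    refine integrableOn_of_continuousOn_of_eq_zero hΩ.measurableSet hζc hζΩ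
      (hζq.continuous.continuousOn.mul ((hnorm hp hDu).add (ha.mul (hnorm hq hDu)))) ?_
    intro x hx
    rw [image_eq_zero_of_notMem_tsupport hx, Real.zero_rpow hq0, zero_mul]
  have hright : IntegrableOn
      (fun x ↦ ‖u x • gradient ζ x‖ ^ p + a x * ‖u x • gradient ζ x‖ ^ q) Ω := by
    refine integrableOn_of_continuousOn_of_eq_zero hΩ.measurableSet hζc hζΩ
      ((hnorm hp huDζ).add (ha.mul (hnorm hq huDζ))) ?_
    intro x hx
    simp [gradient_eq_zero_of_notMem_tsupport hx, Real.zero_rpow hp0, Real.zero_rpow hq0]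
  have hmid : IntegrableOn (fun x ↦ ⟪‖gradient u x‖ ^ (p - 2) • gradient u x +
      a x • ‖gradient u x‖ ^ (q - 2) • gradient u x,
      gradient (fun x ↦ ζ x ^ q * u x) x⟫) Ω := by
    refine integrableOn_of_continuousOn_of_eq_zero hΩ.measurableSet hζc hζΩ
      (hflux.inner hDη) ?_
    intro x hx
    rw [gradient_eq_zero_of_notMem_tsupport fun h ↦ hx (hηsupp h), inner_zero_right]
  have hmono := setIntegral_mono_on hleft ((hmid.const_mul 2).add (hright.const_mul ((2 * q) ^ q)))
    hΩ.measurableSet fun x hx ↦ by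
      have hux : DifferentiableAt ℝ u x :=
        (hu.contDiffAt (hΩ.mem_nhds hx)).differentiableAt one_ne_zero
      have hζx : DifferentiableAt ℝ ζ x := hζ'.contDiffAt.differentiableAt one_ne_zero
      simp only [Pi.add_apply]
      rw [gradient_rpow_mul hq.le hζx hux]
      exact cutoff_double_phase_energy_le hp hpq (hζ0 x) (hζ1 x) (ha0 x hx) _ _
  rw [integral_add' (hmid.const_mul 2) (hright.const_mul _), integral_const_mul,
    integral_const_mul, hweakη] at hmono
  simpa using hmono
end

section
/- (Comparison principle) Let Ω ⊆ ℝⁿ be a bounded open set, let p, q > 1 be real numbers, and let a : Ω → ℝ be continuous with a ≥ 0. Let u, v : Ω → ℝ be continuously differentiable, and suppose that the set {x ∈ Ω : u(x) > v(x)} has compact closure contained in Ω. If ∫_Ω ⟨A(x, ∇u(x)), ∇φ(x)⟩ dx ≤ ∫_Ω ⟨A(x, ∇v(x)), ∇φ(x)⟩ dx for every nonnegative Lipschitz function φ : Ω → ℝ with compact support in Ω, then u(x) ≤ v(x) for every x ∈ Ω. -/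
open RealInnerProductSpace MeasureTheory

/-- The `p`-Laplacian vector field `ξ ↦ ‖ξ‖ ^ (p - 2) • ξ` is continuous for `p > 1`. -/
theorem continuous_norm_rpow_sub_two_smul_s7 {E : Type*} [NormedAddCommGroup E] [NormedSpace ℝ E]
    {p : ℝ} (hp : 1 < p) : Continuous fun ξ : E => ‖ξ‖ ^ (p - 2) • ξ := by
  rw [continuous_iff_continuousAt]
  intro ξ
  rcases eq_or_ne ξ 0 with rfl | hξ
  · have hlim : Filter.Tendsto (fun ξ : E => ‖ξ‖ ^ (p - 1)) (nhds 0) (nhds 0) := by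
      have h : Continuous fun ξ : E => ‖ξ‖ ^ (p - 1) :=
        continuous_norm.rpow_const fun _ => Or.inr (by linarith)
      simpa [Real.zero_rpow (by linarith : p - 1 ≠ 0)] using h.tendsto 0
    unfold ContinuousAt
    simp only [smul_zero]
    refine squeeze_zero_norm (fun ξ => ?_) hlim
    rcases eq_or_ne ξ 0 with rfl | hξ
    · simpa using Real.rpow_nonneg le_rfl _
    · have h0 : 0 < ‖ξ‖ := norm_pos_iff.2 hξ
      rw [norm_smul, Real.norm_of_nonneg (by positivity), ← Real.rpow_add_one h0.ne']
      exact le_of_eq (by ring_nf)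
  · exact (continuous_norm.continuousAt.rpow_const (Or.inl (norm_ne_zero_iff.2 hξ))).smul
      continuousAt_id

section Monotone

variable {E : Type*} [NormedAddCommGroup E] [InnerProductSpace ℝ E]

theorem inner_norm_rpow_sub_two_smul_sub_eq {p : ℝ} (hp : 1 < p) (ξ η : E) :
    ⟪‖ξ‖ ^ (p - 2) • ξ - ‖η‖ ^ (p - 2) • η, ξ - η⟫ =
      (‖ξ‖ ^ (p - 1) - ‖η‖ ^ (p - 1)) * (‖ξ‖ - ‖η‖) +
        (‖ξ‖ ^ (p - 2) + ‖η‖ ^ (p - 2)) * (‖ξ‖ * ‖η‖ - ⟪ξ, η⟫) := by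
  have key : ∀ r : ℝ, 0 ≤ r → r ^ (p - 1) = r ^ (p - 2) * r := by
    intro r hr
    rcases hr.eq_or_lt with rfl | hr
    · simp [Real.zero_rpow (by linarith : p - 1 ≠ 0)]
    · rw [← Real.rpow_add_one hr.ne']
      ring_nf
  rw [key _ (norm_nonneg ξ), key _ (norm_nonneg η)]
  simp only [inner_sub_left, inner_sub_right, real_inner_smul_left,
    real_inner_self_eq_norm_sq, real_inner_comm ξ η]
  ring

theorem rpow_sub_rpow_mul_sub_nonneg {s : ℝ} (hs : 0 ≤ s) {x y : ℝ} (hx : 0 ≤ x) (hy : 0 ≤ y) :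
    0 ≤ (x ^ s - y ^ s) * (x - y) := by
  rcases le_total x y with h | h
  · exact mul_nonneg_of_nonpos_of_nonpos
      (sub_nonpos.2 (Real.rpow_le_rpow hx h hs)) (sub_nonpos.2 h)
  · exact mul_nonneg (sub_nonneg.2 (Real.rpow_le_rpow hy h hs)) (sub_nonneg.2 h)

/-- The `p`-Laplacian vector field is monotone. -/
theorem inner_norm_rpow_sub_two_smul_sub_nonneg {p : ℝ} (hp : 1 < p) (ξ η : E) :
    0 ≤ ⟪‖ξ‖ ^ (p - 2) • ξ - ‖η‖ ^ (p - 2) • η, ξ - η⟫ := by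
  rw [inner_norm_rpow_sub_two_smul_sub_eq hp]
  exact add_nonneg
    (rpow_sub_rpow_mul_sub_nonneg (by linarith) (norm_nonneg _) (norm_nonneg _))
    (mul_nonneg (by positivity) (sub_nonneg.2 (real_inner_le_norm ξ η)))

/-- The `p`-Laplacian vector field is strictly monotone. -/
theorem eq_of_inner_norm_rpow_sub_two_smul_sub_nonpos {p : ℝ} (hp : 1 < p) {ξ η : E}
    (h : ⟪‖ξ‖ ^ (p - 2) • ξ - ‖η‖ ^ (p - 2) • η, ξ - η⟫ ≤ 0) : ξ = η := by
  have hs : 0 < p - 1 := by linarith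
  have hnorm : ‖ξ‖ = ‖η‖ := by
    have h1 := h
    rw [inner_norm_rpow_sub_two_smul_sub_eq hp] at h1
    have h2 : 0 ≤ (‖ξ‖ ^ (p - 2) + ‖η‖ ^ (p - 2)) * (‖ξ‖ * ‖η‖ - ⟪ξ, η⟫) :=
      mul_nonneg (by positivity) (sub_nonneg.2 (real_inner_le_norm ξ η))
    by_contra hne
    rcases lt_or_gt_of_ne hne with hlt | hlt
    · have := mul_pos_of_neg_of_neg
        (sub_neg.2 (Real.rpow_lt_rpow (norm_nonneg ξ) hlt hs)) (sub_neg.2 hlt)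
      linarith
    · have := mul_pos (sub_pos.2 (Real.rpow_lt_rpow (norm_nonneg η) hlt hs)) (sub_pos.2 hlt)
      linarith
  rcases eq_or_ne η 0 with rfl | hη
  · simpa using hnorm
  · rw [hnorm, ← smul_sub, real_inner_smul_left, real_inner_self_eq_norm_sq] at h
    have hpos : 0 < ‖η‖ ^ (p - 2) := Real.rpow_pos_of_pos (norm_pos_iff.2 hη) _
    have h0 : ‖ξ - η‖ ^ 2 ≤ 0 := nonpos_of_mul_nonpos_right h hpos
    exact sub_eq_zero.1 (norm_eq_zero.1 (pow_eq_zero_iff two_ne_zero |>.1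
      (le_antisymm h0 (sq_nonneg _))))

end Monotone

theorem hasDerivAt_max_zero_sq (t : ℝ) :
    HasDerivAt (fun t : ℝ => max t 0 ^ 2) (2 * max t 0) t := by
  rcases lt_trichotomy t 0 with ht | rfl | ht
  · rw [max_eq_right ht.le, mul_zero]
    refine (hasDerivAt_const t (0 : ℝ)).congr_of_eventuallyEq ?_
    filter_upwards [Iio_mem_nhds ht] with s hs
    simp [max_eq_right (le_of_lt (Set.mem_Iio.1 hs))]
  · rw [max_self, mul_zero, hasDerivAt_iff_isLittleO_nhds_zero]
    have hle : (fun h : ℝ => max (0 + h) 0 ^ 2 - max (0 : ℝ) 0 ^ 2 - h • (0 : ℝ))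
        =O[nhds 0] fun h : ℝ => h ^ 2 := by
      refine Asymptotics.IsBigO.of_bound 1 (Filter.Eventually.of_forall fun h => ?_)
      simp only [zero_add, max_self, smul_zero, one_mul, norm_pow, Real.norm_eq_abs]
      rcases le_total h 0 with hh | hh
      · simp [max_eq_right hh]
        positivity
      · simp [max_eq_left hh]
    exact hle.trans_isLittleO (by simpa using Asymptotics.isLittleO_pow_id (𝕜 := ℝ) one_lt_two)
  · rw [max_eq_left ht.le]
    have h : HasDerivAt (fun t : ℝ => t ^ 2) (2 * t) t := by
      simpa using hasDerivAt_pow 2 t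
    refine h.congr_of_eventuallyEq ?_
    filter_upwards [Ioi_mem_nhds ht] with s hs
    simp [max_eq_left (le_of_lt (Set.mem_Ioi.1 hs))]

theorem contDiff_max_zero_sq : ContDiff ℝ 1 fun t : ℝ => max t 0 ^ 2 := by
  rw [contDiff_one_iff_deriv]
  refine ⟨fun t => (hasDerivAt_max_zero_sq t).differentiableAt, ?_⟩
  rw [funext fun t => (hasDerivAt_max_zero_sq t).deriv]
  fun_prop

theorem ContDiffOn.continuousOn_gradient_of_isOpen {E : Type*} [NormedAddCommGroup E]
    [InnerProductSpace ℝ E] [CompleteSpace E] {f : E → ℝ} {s : Set E}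
    (hf : ContDiffOn ℝ 1 f s) (hs : IsOpen s) : ContinuousOn (gradient f) s :=
  (InnerProductSpace.toDual ℝ E).symm.continuous.comp_continuousOn
    (hf.continuousOn_fderiv_of_isOpen hs le_rfl)

/-- Comparison principle for distributional sub/supersolutions (with classical gradients)
of the double-phase equation `−div(|Du|^{p−2}Du + a(x)|Du|^{q−2}Du) = 0`:
if `(u − v)₊` is compactly supported in `Ω` and `u` is a subsolution while `v` is a
supersolution, then `u ≤ v` in `Ω`.  (A Lipschitz test function is differentiable a.e.;
`gradient φ x` is the Lean junk value `0` on the null set where `φ` is not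
differentiable.) -/
theorem stmt_7 (n : ℕ) (hn : 1 ≤ n) (Ω : Set (EuclideanSpace ℝ (Fin n)))
    (hΩo : IsOpen Ω) (hΩb : Bornology.IsBounded Ω)
    (p q : ℝ) (hp : 1 < p) (hq : 1 < q)
    (a : EuclideanSpace ℝ (Fin n) → ℝ) (ha : ContinuousOn a Ω) (ha0 : ∀ x ∈ Ω, 0 ≤ a x)
    (u v : EuclideanSpace ℝ (Fin n) → ℝ)
    (hu : ContDiffOn ℝ 1 u Ω) (hv : ContDiffOn ℝ 1 v Ω)
    (hcpt : IsCompact (closure {x ∈ Ω | v x < u x}))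
    (hsub : closure {x ∈ Ω | v x < u x} ⊆ Ω)
    (hcomp : ∀ φ : EuclideanSpace ℝ (Fin n) → ℝ,
      (∃ K : NNReal, LipschitzWith K φ) → HasCompactSupport φ → tsupport φ ⊆ Ω →
      (∀ x, 0 ≤ φ x) →
      ∫ x in Ω, ⟪‖gradient u x‖ ^ (p - 2) • gradient u x +
          a x • ‖gradient u x‖ ^ (q - 2) • gradient u x, gradient φ x⟫ ≤
        ∫ x in Ω, ⟪‖gradient v x‖ ^ (p - 2) • gradient v x +
          a x • ‖gradient v x‖ ^ (q - 2) • gradient v x, gradient φ x⟫) :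
    ∀ x ∈ Ω, u x ≤ v x := by
  set K := closure {x ∈ Ω | v x < u x} with hK
  set ψ : EuclideanSpace ℝ (Fin n) → ℝ := Ω.indicator fun x => max (u x - v x) 0 ^ 2 with hψ
  have hψΩ : ∀ x ∈ Ω, ψ x = max (u x - v x) 0 ^ 2 := fun x hx => Set.indicator_of_mem hx _
  have hψK : ∀ x, x ∉ K → ψ x = 0 := by
    intro x hx
    by_cases hxΩ : x ∈ Ω
    · have hle : u x ≤ v x := by
        by_contra! h
        exact hx (subset_closure ⟨hxΩ, h⟩)
      simp [hψΩ x hxΩ, hle]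
    · exact Set.indicator_of_notMem hxΩ _
  have hψsupp : HasCompactSupport ψ := HasCompactSupport.intro hcpt hψK
  have hψt : tsupport ψ ⊆ Ω :=
    (closure_minimal (Function.support_subset_iff'.2 hψK) isClosed_closure).trans hsub
  have hψC : ContDiff ℝ 1 ψ := by
    rw [contDiff_iff_contDiffAt]
    intro x
    by_cases hx : x ∈ Ω
    · have hd : ContDiffAt ℝ 1 (fun x => max (u x - v x) 0 ^ 2) x :=
        contDiff_max_zero_sq.contDiffAt.comp x
          ((hu.contDiffAt (hΩo.mem_nhds hx)).sub (hv.contDiffAt (hΩo.mem_nhds hx)))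
      refine hd.congr_of_eventuallyEq ?_
      filter_upwards [hΩo.mem_nhds hx] with y hy using hψΩ y hy
    · refine (contDiffAt_const (c := (0 : ℝ))).congr_of_eventuallyEq ?_
      filter_upwards [isClosed_closure.isOpen_compl.mem_nhds fun h => hx (hsub h)] with y hy
      exact hψK y hy
  have hψgrad : ∀ x ∈ Ω,
      gradient ψ x = (2 * max (u x - v x) 0) • (gradient u x - gradient v x) := by
    intro x hx
    have hΩx := hΩo.mem_nhds hx
    have hdu := ((hu.contDiffAt hΩx).differentiableAt one_ne_zero).hasFDerivAt
    have hdv := ((hv.contDiffAt hΩx).differentiableAt one_ne_zero).hasFDerivAt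
    have hd : HasFDerivAt ψ ((2 * max (u x - v x) 0) • (fderiv ℝ u x - fderiv ℝ v x)) x := by
      refine ((hasDerivAt_max_zero_sq _).comp_hasFDerivAt x (hdu.sub hdv)).congr_of_eventuallyEq ?_
      filter_upwards [hΩx] with y hy using hψΩ y hy
    simp only [gradient, hd.fderiv, map_smul, map_sub]
  have hψgrad0 : ∀ x, x ∉ K → gradient ψ x = 0 := by
    intro x hx
    have hev : ψ =ᶠ[nhds x] fun _ => 0 := by
      filter_upwards [isClosed_closure.isOpen_compl.mem_nhds hx] with y hy using hψK y hy
    simp [gradient, hev.fderiv_eq]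
  have hgψ : Continuous (gradient ψ) :=
    (InnerProductSpace.toDual ℝ _).symm.continuous.comp (hψC.continuous_fderiv one_ne_zero)
  have hflux : ∀ w : EuclideanSpace ℝ (Fin n) → ℝ, ContDiffOn ℝ 1 w Ω →
      ContinuousOn (fun x => ⟪‖gradient w x‖ ^ (p - 2) • gradient w x +
          a x • ‖gradient w x‖ ^ (q - 2) • gradient w x, gradient ψ x⟫) Ω := by
    intro w hw
    have hgw := hw.continuousOn_gradient_of_isOpen hΩo
    exact (((continuous_norm_rpow_sub_two_smul_s7 hp).comp_continuousOn hgw).add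
      (ha.smul ((continuous_norm_rpow_sub_two_smul_s7 hq).comp_continuousOn hgw))).inner
        hgψ.continuousOn
  have hint : ∀ w : EuclideanSpace ℝ (Fin n) → ℝ, ContDiffOn ℝ 1 w Ω →
      IntegrableOn (fun x => ⟪‖gradient w x‖ ^ (p - 2) • gradient w x +
          a x • ‖gradient w x‖ ^ (q - 2) • gradient w x, gradient ψ x⟫) Ω := by
    intro w hw
    refine (((hflux w hw).mono hsub).integrableOn_compact hcpt).of_forall_sdiff_eq_zero
      hΩo.measurableSet fun x hx => ?_
    simp [hψgrad0 x hx.2]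
  have hle := hcomp ψ (hψC.lipschitzWith_of_hasCompactSupport hψsupp one_ne_zero) hψsupp hψt
    fun x => Set.indicator_nonneg (fun _ _ => sq_nonneg _) x
  rw [← sub_nonpos, ← integral_sub (hint u hu) (hint v hv)] at hle
  have hdiff : ∀ x ∈ Ω,
      ⟪‖gradient u x‖ ^ (p - 2) • gradient u x +
          a x • ‖gradient u x‖ ^ (q - 2) • gradient u x, gradient ψ x⟫ -
        ⟪‖gradient v x‖ ^ (p - 2) • gradient v x +
          a x • ‖gradient v x‖ ^ (q - 2) • gradient v x, gradient ψ x⟫ =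
      2 * max (u x - v x) 0 *
        (⟪‖gradient u x‖ ^ (p - 2) • gradient u x - ‖gradient v x‖ ^ (p - 2) • gradient v x,
            gradient u x - gradient v x⟫ +
          a x * ⟪‖gradient u x‖ ^ (q - 2) • gradient u x -
            ‖gradient v x‖ ^ (q - 2) • gradient v x, gradient u x - gradient v x⟫) := by
    intro x hx
    rw [hψgrad x hx, ← inner_sub_left, real_inner_smul_right, ← real_inner_smul_left _ _ (a x),
      ← inner_add_left]
    congr 2
    module
  have hnonneg : ∀ x ∈ Ω, 0 ≤
      ⟪‖gradient u x‖ ^ (p - 2) • gradient u x +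
          a x • ‖gradient u x‖ ^ (q - 2) • gradient u x, gradient ψ x⟫ -
        ⟪‖gradient v x‖ ^ (p - 2) • gradient v x +
          a x • ‖gradient v x‖ ^ (q - 2) • gradient v x, gradient ψ x⟫ := by
    intro x hx
    rw [hdiff x hx]
    exact mul_nonneg (by positivity) (add_nonneg
      (inner_norm_rpow_sub_two_smul_sub_nonneg hp _ _)
      (mul_nonneg (ha0 x hx) (inner_norm_rpow_sub_two_smul_sub_nonneg hq _ _)))
  have hae := (setIntegral_eq_zero_iff_of_nonneg_ae
    ((ae_restrict_iff' hΩo.measurableSet).2 (Filter.Eventually.of_forall hnonneg))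
    ((hint u hu).sub (hint v hv))).1
    (le_antisymm hle (setIntegral_nonneg hΩo.measurableSet hnonneg))
  have hzero := Measure.eqOn_open_of_ae_eq hae hΩo ((hflux u hu).sub (hflux v hv))
    continuousOn_const
  have hgrad0 : ∀ x, gradient ψ x = 0 := by
    intro x
    by_cases hx : x ∈ Ω
    · rw [hψgrad x hx]
      rcases le_or_gt (u x) (v x) with huv | huv
      · simp [huv]
      · have h0 : _ = (0 : ℝ) := hzero hx
        have hpos : 0 < 2 * max (u x - v x) 0 := by
          have := lt_max_of_lt_left (c := (0 : ℝ)) (sub_pos.2 huv)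
          positivity
        have h1 := (mul_eq_zero.1 ((hdiff x hx).symm.trans h0)).resolve_left hpos.ne'
        have h2 := mul_nonneg (ha0 x hx)
          (inner_norm_rpow_sub_two_smul_sub_nonneg hq (gradient u x) (gradient v x))
        have heq : gradient u x = gradient v x :=
          eq_of_inner_norm_rpow_sub_two_smul_sub_nonpos hp (by linarith)
        rw [heq, sub_self, smul_zero]
    · exact hψgrad0 x fun h => hx (hsub h)
  have hfderiv0 : ∀ x, fderiv ℝ ψ x = 0 := fun x =>
    (InnerProductSpace.toDual ℝ _).symm.map_eq_zero_iff.1 (hgrad0 x)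
  have : Nonempty (Fin n) := ⟨⟨0, hn⟩⟩
  obtain ⟨y, hy⟩ : ∃ y, y ∉ K := (Set.ne_univ_iff_exists_notMem K).1 hcpt.ne_univ
  intro x hx
  have hconst := is_const_of_fderiv_eq_zero (hψC.differentiable one_ne_zero) hfderiv0 x y
  rw [hψK y hy, hψΩ x hx, pow_eq_zero_iff two_ne_zero, max_eq_right_iff] at hconst
  exact sub_nonpos.1 hconst
end
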